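/- The function I(x) = h_x(z(x)) is differentiable on (0,1) and its derivative satisfies I′(x) = −ln(1 − (1−z(x))^α) for every x ∈ (0,1). -/

import Mathlib

/-- The function `h_x(z) = ln z - x ln(1-(1-z)^α)` for `z ∈ (0,1)`. -/
noncomputable def hfun (α x : ℝ) : ℝ → ℝ :=
  fun z => Real.log z - x * Real.log (1 - (1 - z) ^ α)

/-- The rate function `I(x) = h_x(z(x))`, where `zf` is the saddle-point map. -/
noncomputable def Ifun (α : ℝ) (zf : ℝ → ℝ) : ℝ → ℝ :=
  fun x => hfun α x (zf x)

open Filter Topology Set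

/-- The value of `x` for which `z` is a critical point of `hfun α x`. -/
noncomputable def saddleValue (α z : ℝ) : ℝ :=
  (1 - (1 - (1 - z) ^ (1 - α)) / z) / α

lemma saddleValue_strictAntiOn {α : ℝ} (hα : α ∈ Ioo (0 : ℝ) 1) :
    StrictAntiOn (saddleValue α) (Ioo 0 1) := by
  intro a ha b hb hab
  have hc := Real.strictConcaveOn_rpow (p := 1 - α) (by linarith [hα.2]) (by linarith [hα.1])
  have key := hc.secant_strict_mono (a := 1) (x := 1 - b) (y := 1 - a) (by simp)
    (mem_Ici.2 (by linarith [hb.2])) (mem_Ici.2 (by linarith [ha.2]))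
    (by linarith [hb.1]) (by linarith [ha.1]) (by linarith)
  have slope_eq (z : ℝ) : ((1 - z) ^ (1 - α) - 1 ^ (1 - α)) / (1 - z - 1) =
      (1 - (1 - z) ^ (1 - α)) / z := by
    rw [Real.one_rpow, ← neg_div_neg_eq]
    ring_nf
  rw [slope_eq, slope_eq] at key
  exact div_lt_div_of_pos_right (by linarith) hα.1

lemma one_sub_one_sub_rpow_pos {α z : ℝ} (hα : 0 < α) (hz : z ∈ Ioo (0 : ℝ) 1) :
    0 < 1 - (1 - z) ^ α :=
  sub_pos.2 (Real.rpow_lt_one (by linarith [hz.2]) (by linarith [hz.1]) hα)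

lemma hasDerivAt_hfun {α z : ℝ} (hα : 0 < α) (x : ℝ) (hz : z ∈ Ioo (0 : ℝ) 1) :
    HasDerivAt (hfun α x)
      ((saddleValue α z - x) * (α * (1 - z) ^ (α - 1) / (1 - (1 - z) ^ α))) z := by
  have hw : 0 < 1 - z := sub_pos.2 hz.2
  have hpos := one_sub_one_sub_rpow_pos hα hz
  have hA : 0 < (1 - z) ^ α := Real.rpow_pos_of_pos hw α
  have h := (Real.hasDerivAt_log hz.1.ne').sub
    ((((((hasDerivAt_id z).const_sub 1).rpow_const (p := α) (Or.inl hw.ne')).const_sub 1).log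
      hpos.ne').const_mul x)
  refine h.congr_deriv ?_
  have hz0 := hz.1.ne'
  simp only [saddleValue, id, Real.rpow_sub hw, Real.rpow_one]
  field_simp
  ring

/-- A critical point of `hfun α x` in `(0,1)` is a global maximum there. -/
lemma hfun_le_of_saddleValue_eq {α x c z : ℝ} (hα : α ∈ Ioo (0 : ℝ) 1)
    (hc : c ∈ Ioo (0 : ℝ) 1) (hcx : saddleValue α c = x) (hz : z ∈ Ioo (0 : ℝ) 1) :
    hfun α x z ≤ hfun α x c := by
  have factor_nonneg : ∀ t ∈ Ioo (0 : ℝ) 1,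
      0 ≤ α * (1 - t) ^ (α - 1) / (1 - (1 - t) ^ α) := fun t ht =>
    div_nonneg (mul_nonneg hα.1.le (Real.rpow_nonneg (by linarith [ht.2]) _))
      (one_sub_one_sub_rpow_pos hα.1 ht).le
  have hanti := (saddleValue_strictAntiOn hα).antitoneOn
  rcases le_total z c with h | h
  · have hsub : Icc z c ⊆ Ioo 0 1 := fun t ht => ⟨hz.1.trans_le ht.1, ht.2.trans_lt hc.2⟩
    refine monotoneOn_of_deriv_nonneg (convex_Icc z c)
      (fun t ht => (hasDerivAt_hfun hα.1 x (hsub ht)).continuousAt.continuousWithinAt)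
      (fun t ht => (hasDerivAt_hfun hα.1 x
        (hsub (interior_subset ht))).differentiableAt.differentiableWithinAt)
      (fun t ht => ?_) (left_mem_Icc.2 h) (right_mem_Icc.2 h) h
    have ht' := interior_subset ht
    rw [(hasDerivAt_hfun hα.1 x (hsub ht')).deriv]
    exact mul_nonneg (sub_nonneg.2 (hcx ▸ hanti (hsub ht') hc ht'.2))
      (factor_nonneg t (hsub ht'))
  · have hsub : Icc c z ⊆ Ioo 0 1 := fun t ht => ⟨hc.1.trans_le ht.1, ht.2.trans_lt hz.2⟩
    refine antitoneOn_of_deriv_nonpos (convex_Icc c z)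
      (fun t ht => (hasDerivAt_hfun hα.1 x (hsub ht)).continuousAt.continuousWithinAt)
      (fun t ht => (hasDerivAt_hfun hα.1 x
        (hsub (interior_subset ht))).differentiableAt.differentiableWithinAt)
      (fun t ht => ?_) (left_mem_Icc.2 h) (right_mem_Icc.2 h) h
    have ht' := interior_subset ht
    rw [(hasDerivAt_hfun hα.1 x (hsub ht')).deriv]
    exact mul_nonpos_of_nonpos_of_nonneg (sub_nonpos.2 (hcx ▸ hanti hc (hsub ht') ht'.1))
      (factor_nonneg t (hsub ht'))

lemma saddleValue_eq_of_deriv_eq_zero {α x z : ℝ} (hα : 0 < α) (hz : z ∈ Ioo (0 : ℝ) 1)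
    (h : deriv (hfun α x) z = 0) : saddleValue α z = x := by
  rw [(hasDerivAt_hfun hα x hz).deriv] at h
  have hpos : 0 < α * (1 - z) ^ (α - 1) / (1 - (1 - z) ^ α) :=
    div_pos (mul_pos hα (Real.rpow_pos_of_pos (sub_pos.2 hz.2) _))
      (one_sub_one_sub_rpow_pos hα hz)
  exact sub_eq_zero.1 ((mul_eq_zero.1 h).resolve_right hpos.ne')

/-- A right inverse of a strictly antitone function on an open interval is continuous. -/
lemma continuousAt_of_strictAntiOn_rightInverse {g f : ℝ → ℝ} {l u x : ℝ}
    (hg : StrictAntiOn g (Ioo l u)) (hf : ∀ᶠ y in 𝓝 x, f y ∈ Ioo l u ∧ g (f y) = y) :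
    ContinuousAt f x := by
  obtain ⟨hx, hgx⟩ := hf.self_of_nhds
  refine tendsto_order.2 ⟨fun a ha => ?_, fun b hb => ?_⟩
  · obtain ⟨c, hc, hcx⟩ := exists_between (max_lt ha hx.1)
    have hc' : c ∈ Ioo l u := ⟨(le_max_right _ _).trans_lt hc, hcx.trans hx.2⟩
    have hxc : x < g c := by simpa only [hgx] using hg hc' hx hcx
    filter_upwards [hf, eventually_lt_nhds hxc] with y hy hyc
    rw [← hy.2] at hyc
    exact ((le_max_left _ _).trans_lt hc).trans ((hg.lt_iff_gt hy.1 hc').1 hyc)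
  · obtain ⟨c, hxc, hc⟩ := exists_between (lt_min hb hx.2)
    have hc' : c ∈ Ioo l u := ⟨hx.1.trans hxc, hc.trans_le (min_le_right _ _)⟩
    have hcx : g c < x := by simpa only [hgx] using hg hx hc' hxc
    filter_upwards [hf, eventually_gt_nhds hcx] with y hy hyc
    rw [← hy.2] at hyc
    exact ((hg.lt_iff_gt hc' hy.1).1 hyc).trans (hc.trans_le (min_le_left _ _))

/-- A function with a continuous selection `s` of subgradients has derivative `s x`. -/
lemma hasDerivAt_of_subgradient {F s : ℝ → ℝ} {x : ℝ} (hs : ContinuousAt s x)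
    (h : ∀ᶠ y in 𝓝 x, F x + s x * (y - x) ≤ F y ∧ F y + s y * (x - y) ≤ F x) :
    HasDerivAt F (s x) x := by
  rw [hasDerivAt_iff_isLittleO, Asymptotics.isLittleO_iff]
  intro ε hε
  filter_upwards [h, Metric.continuousAt_iff'.1 hs ε hε] with y hy hd
  rw [Real.dist_eq] at hd
  rw [smul_eq_mul, Real.norm_eq_abs, Real.norm_eq_abs, abs_of_nonneg (by linarith [hy.1])]
  calc F y - F x - (y - x) * s x ≤ (s y - s x) * (y - x) := by linarith [hy.2]
    _ ≤ |s y - s x| * |y - x| := (le_abs_self _).trans (abs_mul _ _).le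
    _ ≤ ε * |y - x| := by gcongr

/-- `I(x) = h_x(z(x))` is differentiable on `(0,1)` with
`I'(x) = -ln(1-(1-z(x))^α)`. -/
theorem rate_function_derivative (α : ℝ) (hα : α ∈ Set.Ioo (0 : ℝ) 1)
    (zf : ℝ → ℝ)
    (hzf : ∀ x ∈ Set.Ioo (0 : ℝ) 1, zf x ∈ Set.Ioo (0 : ℝ) 1 ∧
      deriv (hfun α x) (zf x) = 0) :
    ∀ x ∈ Set.Ioo (0 : ℝ) 1,
      HasDerivAt (Ifun α zf) (-Real.log (1 - (1 - zf x) ^ α)) x := by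
  intro x hx
  have hsaddle : ∀ y ∈ Ioo (0 : ℝ) 1, zf y ∈ Ioo (0 : ℝ) 1 ∧ saddleValue α (zf y) = y :=
    fun y hy => ⟨(hzf y hy).1, saddleValue_eq_of_deriv_eq_zero hα.1 (hzf y hy).1 (hzf y hy).2⟩
  have hnear : ∀ᶠ y in 𝓝 x, y ∈ Ioo (0 : ℝ) 1 := isOpen_Ioo.mem_nhds hx
  have hcont : ContinuousAt zf x :=
    continuousAt_of_strictAntiOn_rightInverse (saddleValue_strictAntiOn hα) (hnear.mono hsaddle)
  obtain ⟨hzx, hsx⟩ := hsaddle x hx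
  refine hasDerivAt_of_subgradient (s := fun y => -Real.log (1 - (1 - zf y) ^ α)) ?_ ?_
  · exact ((continuousAt_const.sub ((continuousAt_const.sub hcont).rpow_const
      (Or.inr hα.1.le))).log (one_sub_one_sub_rpow_pos hα.1 hzx).ne').neg
  · filter_upwards [hnear] with y hy
    obtain ⟨hzy, hsy⟩ := hsaddle y hy
    have hxy := hfun_le_of_saddleValue_eq hα hzy hsy hzx
    have hyx := hfun_le_of_saddleValue_eq hα hzx hsx hzy
    simp only [Ifun, hfun] at *
    constructor <;> linarith
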